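/- Fix x > 0, let B(x) be the unique solution B ∈ (0,1) of e^{−xB} = B and set A(x) := 1/(B(x)(1 + x B(x))). Define g(z) := 1 + 1/(z·B(x) − exp(−z·x·B(x))) − A(x)/(z − 1) for complex z with Re(z) > 1. Then g(z) tends to the limit 1 + x²·B(x)/(2·(1 + x·B(x))²) as z → 1 within the half-plane {Re(z) > 1}; in particular the singularity of g at z = 1 is removable from that half-plane. -/

import Mathlib

open Filter

/-- The second-order difference quotient of `exp` at `0` tends to `1 / 2`. -/
theorem tendsto_exp_sub_one_sub_id_div_sq :
    Tendsto (fun u : ℂ => (Complex.exp u - 1 - u) / u ^ 2)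
      (nhdsWithin 0 {0}ᶜ) (nhds (1 / 2)) := by
  have h := ((Complex.exp_sub_sum_range_succ_isLittleO_pow 2).tendsto_div_nhds_zero.mono_left
    (nhdsWithin_le_nhds (s := {0}ᶜ))).add_const (1 / 2 : ℂ)
  rw [zero_add] at h
  refine h.congr' ?_
  filter_upwards [self_mem_nhdsWithin] with u hu
  have hu : u ≠ 0 := hu
  simp only [Finset.sum_range_succ, Finset.sum_range_zero, Nat.factorial]
  push_cast
  field_simp
  ring

/-- For `x > 0`, `B = B(x) ∈ (0,1)` the solution of `e^{-xB} = B`, and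
`A(x) = 1/(B(1+xB))`, the function
`g(z) = 1 + 1/(zB - exp(-zxB)) - A(x)/(z-1)` tends to
`1 + x²B/(2(1+xB)²)` as `z → 1` within the half-plane `{Re z > 1}`. -/
theorem stmt_15 (x : ℝ) (hx : 0 < x) (B : ℝ)
    (hB0 : 0 < B) (hB1 : B < 1) (hBeq : Real.exp (-(x * B)) = B) :
    Tendsto
      (fun z : ℂ => 1 + 1 / (z * B - Complex.exp (-(z * x * B))) -
        ((1 / (B * (1 + x * B)) : ℝ) : ℂ) / (z - 1))
      (nhdsWithin 1 {z : ℂ | 1 < z.re})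
      (nhds (1 + (x ^ 2 * B / (2 * (1 + x * B) ^ 2) : ℝ))) := by
  have hBC : (B : ℂ) ≠ 0 := by exact_mod_cast hB0.ne'
  have hxC : (x : ℂ) ≠ 0 := by exact_mod_cast hx.ne'
  have hc : (1 + x * B : ℂ) ≠ 0 := by
    have : 1 + x * B ≠ 0 := by positivity
    exact_mod_cast this
  have hne : ∀ z ∈ {z : ℂ | 1 < z.re}, z - 1 ≠ 0 := by
    intro z hz h
    rw [sub_eq_zero.mp h] at hz
    simp at hz
  have hexp : Complex.exp (-(x * B)) = B := by exact_mod_cast congrArg Complex.ofReal hBeq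
  have hw : Tendsto (fun z : ℂ => z - 1) (nhdsWithin 1 {z : ℂ | 1 < z.re}) (nhds 0) := by
    have : Tendsto (fun z : ℂ => z - 1) (nhds 1) (nhds (1 - 1)) :=
      Continuous.tendsto (by fun_prop) 1
    rw [sub_self] at this
    exact this.mono_left nhdsWithin_le_nhds
  have hu : Tendsto (fun z : ℂ => -(x * B) * (z - 1)) (nhdsWithin 1 {z : ℂ | 1 < z.re})
      (nhdsWithin 0 {0}ᶜ) := by
    refine tendsto_nhdsWithin_iff.mpr ⟨by simpa using hw.const_mul (-(x * B) : ℂ), ?_⟩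
    filter_upwards [self_mem_nhdsWithin] with z hz
    exact mul_ne_zero (neg_ne_zero.mpr (mul_ne_zero hxC hBC)) (hne z hz)
  obtain ⟨h, hh⟩ : ∃ h : ℂ → ℂ, h = fun z => (x * B : ℂ) ^ 2 *
      ((Complex.exp (-(x * B) * (z - 1)) - 1 - -(x * B) * (z - 1)) /
        (-(x * B) * (z - 1)) ^ 2) := ⟨_, rfl⟩
  have hlim : Tendsto h (nhdsWithin 1 {z : ℂ | 1 < z.re}) (nhds ((x * B : ℂ) ^ 2 * (1 / 2))) := by
    rw [hh]
    exact (tendsto_exp_sub_one_sub_id_div_sq.comp hu).const_mul _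
  have hD : Tendsto (fun z => (1 + x * B : ℂ) - (z - 1) * h z)
      (nhdsWithin 1 {z : ℂ | 1 < z.re}) (nhds (1 + x * B)) := by
    simpa using (hw.mul hlim).const_sub (1 + x * B : ℂ)
  have hmain := (hlim.div (hD.const_mul (B * (1 + x * B) : ℂ))
    (mul_ne_zero (mul_ne_zero hBC hc) hc)).const_add 1
  have hval : (1 : ℂ) + (x * B : ℂ) ^ 2 * (1 / 2) / (B * (1 + x * B) * (1 + x * B)) =
      1 + (x ^ 2 * B / (2 * (1 + x * B) ^ 2) : ℝ) := by
    push_cast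
    field_simp
  rw [hval] at hmain
  refine hmain.congr' ?_
  filter_upwards [self_mem_nhdsWithin, hD.eventually_ne hc] with z hz hDz
  have hz1 := hne z hz
  have hden : z * B - Complex.exp (-(z * x * B)) =
      B * (z - 1) * ((1 + x * B : ℂ) - (z - 1) * h z) := by
    have he : Complex.exp (-(z * x * B)) = B * Complex.exp (-(x * B) * (z - 1)) := by
      nth_rewrite 2 [← hexp]
      rw [← Complex.exp_add]
      congr 1
      ring
    rw [he, hh]
    field_simp
    ring
  rw [hden]
  simp only [Pi.div_apply]
  push_cast
  generalize h z = k at *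
  have key : 1 / (B * (z - 1) * ((1 + x * B : ℂ) - (z - 1) * k)) -
      1 / (B * (1 + x * B)) / (z - 1) =
      k / (B * (1 + x * B) * ((1 + x * B : ℂ) - (z - 1) * k)) := by
    generalize (1 + x * B : ℂ) = c at *
    generalize z - 1 = w at *
    field_simp
    ring
  rw [← key]
  ring
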